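/- Let a : ℝ → ℝ be positive and continuously differentiable on (0,∞), and fix χ > 0. Suppose that on an open interval I ⊆ (0,∞) there is a function t_ℓ : I → ℝ with 0 < t_ℓ(τ) < τ and ∫_{t_ℓ(τ)}^{τ} ds/a(s) = χ for all τ ∈ I, and define δ(τ) = (1/a(τ)) ∫_{t_ℓ(τ)}^{τ} a(s) ds. Define the Hubble parameter H(τ) = a'(τ)/a(τ) and the redshift z(τ) by 1 + z(τ) = a(τ)/a(t_ℓ(τ)). Then δ'(τ) = 1 − H(τ) δ(τ) − 1/(1 + z(τ))². -/

import Mathlib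

open Real Set MeasureTheory intervalIntegral

/-- A primitive, based at `1`, of a function continuous on `(0, ∞)` is strictly differentiable
there. -/
theorem hasStrictDerivAt_integral_of_continuousOn_Ioi {f : ℝ → ℝ}
    (hf : ContinuousOn f (Ioi 0)) {t : ℝ} (ht : 0 < t) :
    HasStrictDerivAt (fun x => ∫ s in (1 : ℝ)..x, f s) (f t) t := by
  refine integral_hasStrictDerivAt_right ?_ ?_ (hf.continuousAt (Ioi_mem_nhds ht))
  · refine (hf.mono fun x hx => ?_).intervalIntegrable
    exact lt_of_lt_of_le (lt_min one_pos ht) hx.1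
  · exact hf.stronglyMeasurableAtFilter isOpen_Ioi t ht

theorem integral_eq_sub_of_continuousOn_Ioi {f : ℝ → ℝ}
    (hf : ContinuousOn f (Ioi 0)) {s t : ℝ} (hs : 0 < s) (ht : 0 < t) :
    ∫ x in s..t, f x = (∫ x in (1 : ℝ)..t, f x) - ∫ x in (1 : ℝ)..s, f x := by
  have hint : ∀ u, 0 < u → IntervalIntegrable f volume 1 u := fun u hu =>
    (hf.mono fun x hx => lt_of_lt_of_le (lt_min one_pos hu) hx.1).intervalIntegrable
  exact (integral_interval_sub_left (hint t ht) (hint s hs)).symm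

/-- If `F` is injective on an open set `s` in which `u` takes its values near `τ`, then `u` is
differentiable wherever `F ∘ u` is and `F` has nonzero strict derivative. -/
theorem HasStrictDerivAt.hasDerivAt_of_comp_of_injOn {F u v : ℝ → ℝ} {s : Set ℝ}
    {F' v' τ : ℝ} (hs : IsOpen s) (hinj : InjOn F s) (hF : HasStrictDerivAt F F' (u τ))
    (hF' : F' ≠ 0) (hv : HasDerivAt v v' τ) (hu : ∀ᶠ x in nhds τ, u x ∈ s)
    (huv : ∀ᶠ x in nhds τ, F (u x) = v x) :
    HasDerivAt u (F'⁻¹ * v') τ := by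
  have hv0 : F (u τ) = v τ := huv.self_of_nhds
  have hG := hF.to_localInverse hF'
  set G := hF.localInverse F F' (u τ) hF'
  have hequiv := hF.hasStrictFDerivAt_equiv hF'
  have hG0 : G (F (u τ)) = u τ := hequiv.localInverse_apply_image
  have hright : ∀ᶠ y in nhds (F (u τ)), F (G y) = y := hequiv.eventually_right_inverse
  have hmem : ∀ᶠ y in nhds (F (u τ)), G y ∈ s :=
    hG.hasDerivAt.continuousAt.eventually_mem (by
      rw [hG0]; exact hs.mem_nhds hu.self_of_nhds)
  rw [hv0] at hG hright hmem
  have hcomp : HasDerivAt (fun x => G (v x)) (F'⁻¹ * v') τ := hG.hasDerivAt.comp τ hv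
  refine hcomp.congr_of_eventuallyEq ?_
  filter_upwards [hu, huv, hv.continuousAt.eventually hright,
    hv.continuousAt.eventually hmem] with x hx hFx hr hm
  exact hinj hx hm (hFx.trans hr.symm)

/-- Hubble-law form of the astrometric relative velocity:
`δ'(τ) = 1 − H(τ) δ(τ) − 1/(1+z(τ))²`, where `H = a'/a` is the Hubble parameter and
`1 + z = a(τ)/a(t_ℓ(τ))` is the redshift. -/
theorem astrometric_hubble_law
    (a a' : ℝ → ℝ) (χ : ℝ) (hχ : 0 < χ)
    (hapos : ∀ t ∈ Ioi (0:ℝ), 0 < a t)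
    (hderiv : ∀ t ∈ Ioi (0:ℝ), HasDerivAt a (a' t) t)
    (hcont : ContinuousOn a' (Ioi 0))
    (I : Set ℝ) (b c : ℝ) (hI : I = Ioo b c) (hIsub : I ⊆ Ioi 0)
    (tl : ℝ → ℝ)
    (htl : ∀ τ ∈ I, 0 < tl τ ∧ tl τ < τ)
    (hchi : ∀ τ ∈ I, (∫ s in tl τ..τ, 1 / a s) = χ)
    (δ : ℝ → ℝ)
    (hδ : ∀ τ, δ τ = (1 / a τ) * ∫ s in tl τ..τ, a s)
    (H z : ℝ → ℝ)
    (hH : ∀ τ ∈ I, H τ = a' τ / a τ)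
    (hz : ∀ τ ∈ I, 1 + z τ = a τ / a (tl τ)) :
    ∀ τ ∈ I, HasDerivAt δ (1 - H τ * δ τ - 1 / (1 + z τ)^2) τ := by
  intro τ hτ
  have hca : ContinuousOn a (Ioi 0) := fun t ht => (hderiv t ht).continuousAt.continuousWithinAt
  have hcinv : ContinuousOn (fun s => 1 / a s) (Ioi 0) :=
    continuousOn_const.div hca fun t ht => (hapos t ht).ne'
  have hnhds : ∀ᶠ x in nhds τ, x ∈ I := (hI ▸ isOpen_Ioo : IsOpen I).mem_nhds hτ
  have hτ0 : 0 < τ := hIsub hτ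
  have ht0 := (htl τ hτ).1
  have haτ := hapos τ hτ0
  have hat := hapos (tl τ) ht0
  have hF := fun t (ht : 0 < t) => hasStrictDerivAt_integral_of_continuousOn_Ioi hcinv ht
  have hA := fun t (ht : 0 < t) => hasStrictDerivAt_integral_of_continuousOn_Ioi hca ht
  have hmono : StrictMonoOn (fun x => ∫ s in (1 : ℝ)..x, 1 / a s) (Ioi 0) := by
    refine strictMonoOn_of_deriv_pos (convex_Ioi 0)
      (fun t ht => (hF t ht).hasDerivAt.continuousAt.continuousWithinAt) fun t ht => ?_
    rw [interior_Ioi] at ht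
    rw [(hF t ht).hasDerivAt.deriv]
    exact one_div_pos.2 (hapos t ht)
  have htl' : HasDerivAt tl ((1 / a (tl τ))⁻¹ * (1 / a τ)) τ := by
    refine (hF (tl τ) ht0).hasDerivAt_of_comp_of_injOn isOpen_Ioi hmono.injOn
      (one_div_pos.2 hat).ne' ((hF τ hτ0).hasDerivAt.sub_const χ)
      (hnhds.mono fun x hx => (htl x hx).1) (hnhds.mono fun x hx => ?_)
    have := integral_eq_sub_of_continuousOn_Ioi hcinv (htl x hx).1 (hIsub hx)
    rw [hchi x hx] at this
    linarith
  have hint : HasDerivAt (fun x => ∫ s in tl x..x, a s)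
      (a τ - a (tl τ) * ((1 / a (tl τ))⁻¹ * (1 / a τ))) τ := by
    have := (hA τ hτ0).hasDerivAt.sub ((hA (tl τ) ht0).hasDerivAt.comp τ htl')
    refine this.congr_of_eventuallyEq (hnhds.mono fun x hx => ?_)
    exact integral_eq_sub_of_continuousOn_Ioi hca (htl x hx).1 (hIsub hx)
  rw [funext hδ]
  refine (((hasDerivAt_const τ (1 : ℝ)).div (hderiv τ hτ0) haτ.ne').mul hint).congr_deriv ?_
  simp only [Pi.div_apply]
  rw [hH τ hτ, hz τ hτ]
  field_simp
  ring
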